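/- Let U = P_i ⊗ V_i + (1 − P_i) for families of commuting control projectors, and more generally let U_h = (∏_{i=1}^l ∏_{j=0}^{w−2} U_i^j)·U^≠ be the superposition-oracle hash unitary on registers X, Y and hash-chain registers Γ_i^j, where each U_i^j = P⁼_{XΓ_i^j}⊗(CNOT^{⊗n}_{Γ_i^{j+1}:Y} − 1) + 1 and U^≠ = P^≠_{XΓ}·(U′_{XY} − 1) + 1 with P^≠_{XΓ} = ∏_{i,j} (1 − P⁼_{XΓ_i^j}) and U′ a unitary acting only on XY. Then for any i′ ∈ {1,…,l} and j′ ∈ {0,…,w−2}, the operator norm of the commutator of U_h with the projector Φ^{⊗(j′+1)} on registers Γ_{i′}^0,…,Γ_{i′}^{j′} (the uniform-superposition projector on the first j′+1 elements of the i′-th chain) is at most 6(w−1)·2^{−n/2}. -/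

import Mathlib

open scoped Matrix

namespace Stmt9

/-- Basis labels for an `n`-qubit register. -/
abbrev Bn (n : ℕ) := Fin n → Bool

/-- Basis labels for the full system: query registers `X`, `Y` and hash-chain registers
`Γ_i^j` for `i ∈ {1,…,l}`, `j ∈ {0,…,w−1}` (with `w = w'+1`). -/
abbrev Idx (n l w' : ℕ) := Bn n × Bn n × ((Fin l × Fin (w' + 1)) → Bn n)

/-- The equality projector `P⁼_{XΓ_i^j}` comparing the input register `X` with the
hash-chain register `Γ_i^j` (identity on everything else). -/
noncomputable def Peq (n l w' : ℕ) (i : Fin l) (j : Fin (w' + 1)) :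
    Matrix (Idx n l w') (Idx n l w') ℂ :=
  fun p q => if p.1 = p.2.2 (i, j) ∧ q = p then 1 else 0

/-- The transversal CNOT `CNOT^{⊗n}_{Γ_i^j : Y}` XOR-ing the contents of `Γ_i^j`
into the output register `Y`. -/
noncomputable def Cnot (n l w' : ℕ) (i : Fin l) (j : Fin (w' + 1)) :
    Matrix (Idx n l w') (Idx n l w') ℂ :=
  fun p q =>
    if q.1 = p.1 ∧ q.2.2 = p.2.2 ∧ q.2.1 = (fun t => xor (p.2.1 t) (p.2.2 (i, j) t))
      then 1 else 0

/-- `U_i^j = P⁼_{XΓ_i^j} ⊗ (CNOT^{⊗n}_{Γ_i^{j+1}:Y} − 1) + 1`. -/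
noncomputable def Uij (n l w' : ℕ) (i : Fin l) (j : Fin w') :
    Matrix (Idx n l w') (Idx n l w') ℂ :=
  Peq n l w' i j.castSucc * (Cnot n l w' i j.succ - 1) + 1

/-- `P^≠_{XΓ} = ∏_{i,j≤w−2} (1 − P⁼_{XΓ_i^j})`: the (diagonal) projector onto basis
states where `X` differs from all hash-chain registers `Γ_i^j`, `j ≤ w−2`. -/
noncomputable def Pneq (n l w' : ℕ) :
    Matrix (Idx n l w') (Idx n l w') ℂ :=
  fun p q =>
    if (∀ (i : Fin l) (j : Fin w'), p.1 ≠ p.2.2 (i, j.castSucc)) ∧ q = p then 1 else 0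

/-- The extension to the full system of a unitary `U′` acting only on `XY`. -/
noncomputable def Uext (n l w' : ℕ) (U0 : Matrix (Bn n × Bn n) (Bn n × Bn n) ℂ) :
    Matrix (Idx n l w') (Idx n l w') ℂ :=
  fun p q => if q.2.2 = p.2.2 then U0 (p.1, p.2.1) (q.1, q.2.1) else 0

/-- `U^≠ = P^≠_{XΓ}·(U′_{XY} − 1) + 1`. -/
noncomputable def Uneq (n l w' : ℕ) (U0 : Matrix (Bn n × Bn n) (Bn n × Bn n) ℂ) :
    Matrix (Idx n l w') (Idx n l w') ℂ :=
  Pneq n l w' * (Uext n l w' U0 - 1) + 1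

/-- The superposition-oracle hash unitary
`U_h = (∏_{i=1}^l ∏_{j=0}^{w−2} U_i^j) · U^≠`. -/
noncomputable def Uh (n l w' : ℕ) (U0 : Matrix (Bn n × Bn n) (Bn n × Bn n) ℂ) :
    Matrix (Idx n l w') (Idx n l w') ℂ :=
  (List.ofFn fun i : Fin l => (List.ofFn fun j : Fin w' => Uij n l w' i j).prod).prod *
    Uneq n l w' U0

/-- The projector `Φ^{⊗(j'+1)}` onto the uniform superposition on the registers
`Γ_{i'}^0, …, Γ_{i'}^{j'}` (identity elsewhere); each rank-one factor
`|Φ⟩⟨Φ|` has all entries `2^{−n}`. -/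
noncomputable def chainPhi (n l w' : ℕ) (i' : Fin l) (j' : Fin w') :
    Matrix (Idx n l w') (Idx n l w') ℂ :=
  fun p q =>
    if p.1 = q.1 ∧ p.2.1 = q.2.1 ∧
        (∀ (i : Fin l) (k : Fin (w' + 1)),
          (i ≠ i' ∨ (j' : ℕ) < (k : ℕ)) → p.2.2 (i, k) = q.2.2 (i, k))
      then (((2 : ℂ) ^ n)⁻¹) ^ ((j' : ℕ) + 1) else 0

section helpers

open scoped Matrix.Norms.L2Operator Kronecker

section gen

variable {ι : Type*} [Fintype ι] [DecidableEq ι]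

lemma norm_le_one_of_isometry (A : Matrix ι ι ℂ) (h : Aᴴ * A = 1) : ‖A‖ ≤ 1 := by
  have h1 : ‖(1 : Matrix ι ι ℂ)‖ ≤ 1 := by
    have := CStarRing.norm_star_mul_self (x := (1 : Matrix ι ι ℂ))
    simp only [star_one, mul_one] at this
    nlinarith [norm_nonneg (1 : Matrix ι ι ℂ)]
  have h2 := CStarRing.norm_star_mul_self (x := A)
  rw [Matrix.star_eq_conjTranspose, h] at h2
  nlinarith [norm_nonneg A]

lemma norm_le_one_of_proj (A : Matrix ι ι ℂ) (h : Aᴴ = A) (h' : A * A = A) : ‖A‖ ≤ 1 := by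
  have h2 := CStarRing.norm_star_mul_self (x := A)
  rw [Matrix.star_eq_conjTranspose, h, h'] at h2
  nlinarith [norm_nonneg A]

lemma norm_one_le : ‖(1 : Matrix ι ι ℂ)‖ ≤ 1 :=
  norm_le_one_of_proj _ (by simp) (by simp)

lemma clm_comm_bound {E : Type*} [NormedAddCommGroup E] [InnerProductSpace ℂ E] [CompleteSpace E]
    (Q F : E →L[ℂ] E) (hF : star F = F) (hFF : F * F = F) (c : ℝ)
    (h1 : ‖Q * F‖ ≤ c) (h2 : ‖F * Q‖ ≤ c) : ‖Q * F - F * Q‖ ≤ c := by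
  have hc : 0 ≤ c := (norm_nonneg _).trans h1
  have hFF' : ∀ v, F (F v) = F v := fun v => by
    conv_rhs => rw [← hFF]
    rfl
  have pyth : ∀ u, ‖u‖ ^ 2 = ‖F u‖ ^ 2 + ‖u - F u‖ ^ 2 := by
    intro u
    have h0 : inner ℂ (F u) (u - F u) = 0 := by
      have := ContinuousLinearMap.adjoint_inner_left F (u - F u) u
      rw [← ContinuousLinearMap.star_eq_adjoint, hF, map_sub, hFF', sub_self, inner_zero_right] at this
      exact this
    have := norm_add_sq_eq_norm_sq_add_norm_sq_of_inner_eq_zero (F u) (u - F u) h0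
    rw [add_sub_cancel] at this
    nlinarith
  refine ContinuousLinearMap.opNorm_le_bound _ hc fun v => ?_
  set D := (Q * F - F * Q) v with hD
  have hDv : D = Q (F v) - F (Q v) := rfl
  have e1 : F D = - (F * Q) (v - F v) := by
    rw [hDv]; simp [hFF']
  have b1 : ‖F D‖ ≤ c * ‖v - F v‖ := by
    rw [e1, norm_neg]
    exact ContinuousLinearMap.le_of_opNorm_le _ h2 _
  have e2 : D - F D = (Q * F) (F v) - F ((Q * F) (F v)) := by
    rw [hDv]; simp [hFF']
  have b2 : ‖D - F D‖ ≤ c * ‖F v‖ := by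
    have h3 : ‖(Q * F) (F v)‖ ≤ c * ‖F v‖ := ContinuousLinearMap.le_of_opNorm_le _ h1 _
    have h4 := pyth ((Q * F) (F v))
    rw [← e2] at h4
    refine le_trans ?_ h3
    refine abs_le_of_sq_le_sq' ?_ (norm_nonneg _) |>.2
    nlinarith [sq_nonneg ‖F ((Q * F) (F v))‖]
  refine abs_le_of_sq_le_sq' ?_ (by positivity) |>.2
  have p1 := pyth D
  have p2 := pyth v
  have q1 := pow_le_pow_left₀ (norm_nonneg _) b1 2
  have q2 := pow_le_pow_left₀ (norm_nonneg _) b2 2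
  rw [p1, mul_pow, p2]
  nlinarith

lemma comm_bound (Q F : Matrix ι ι ℂ) (hF : Fᴴ = F) (hFF : F * F = F) (c : ℝ)
    (h1 : ‖Q * F‖ ≤ c) (h2 : ‖F * Q‖ ≤ c) : ‖Q * F - F * Q‖ ≤ c := by
  have := clm_comm_bound (Matrix.toEuclideanCLM (𝕜 := ℂ) Q) (Matrix.toEuclideanCLM (𝕜 := ℂ) F)
    (by rw [← map_star, Matrix.star_eq_conjTranspose, hF]) (by rw [← map_mul, hFF]) c
    (by rw [← map_mul]; exact h1) (by rw [← map_mul]; exact h2)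
  rw [← map_mul, ← map_mul, ← map_sub] at this
  exact this

lemma norm_ofFn_prod_le {m : ℕ} (f : Fin m → Matrix ι ι ℂ) (hf : ∀ i, ‖f i‖ ≤ 1) :
    ‖(List.ofFn f).prod‖ ≤ 1 := by
  induction m with
  | zero => simpa using norm_one_le
  | succ m ih =>
    rw [List.ofFn_succ, List.prod_cons]
    exact (norm_mul_le _ _).trans (mul_le_one₀ (hf 0) (norm_nonneg _) (ih _ fun i => hf _))

lemma comm_ofFn_prod_le {m : ℕ} (f : Fin m → Matrix ι ι ℂ) (hf : ∀ i, ‖f i‖ ≤ 1)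
    (F : Matrix ι ι ℂ) :
    ‖(List.ofFn f).prod * F - F * (List.ofFn f).prod‖ ≤ ∑ i, ‖f i * F - F * f i‖ := by
  induction m with
  | zero => simp
  | succ m ih =>
    rw [List.ofFn_succ, List.prod_cons, Fin.sum_univ_succ]
    set R := (List.ofFn fun i : Fin m => f i.succ).prod
    have hR : ‖R‖ ≤ 1 := norm_ofFn_prod_le _ fun i => hf _
    have e : f 0 * R * F - F * (f 0 * R) = (f 0 * F - F * f 0) * R + f 0 * (R * F - F * R) := by
      noncomm_ring
    rw [e]
    refine (norm_add_le _ _).trans (add_le_add ?_ ?_)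
    · exact (norm_mul_le _ _).trans (mul_le_of_le_one_right (norm_nonneg _) hR)
    · exact (norm_mul_le _ _).trans ((mul_le_of_le_one_left (norm_nonneg _) (hf 0)).trans
        (ih _ fun i => hf _))

lemma nested_bound {l m : ℕ} (g : Fin l → Fin m → Matrix ι ι ℂ) (hg : ∀ i j, ‖g i j‖ ≤ 1)
    (F : Matrix ι ι ℂ) (i' : Fin l) (c : ℝ)
    (h0 : ∀ i j, i ≠ i' → g i j * F - F * g i j = 0)
    (hc : ∀ j, ‖g i' j * F - F * g i' j‖ ≤ c) :
    ‖(List.ofFn fun i => (List.ofFn fun j => g i j).prod).prod * F -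
      F * (List.ofFn fun i => (List.ofFn fun j => g i j).prod).prod‖ ≤ m * c := by
  refine (comm_ofFn_prod_le _ (fun i => norm_ofFn_prod_le _ (hg i)) F).trans ?_
  have : ∀ i, ‖(List.ofFn fun j => g i j).prod * F - F * (List.ofFn fun j => g i j).prod‖ ≤
      if i = i' then m * c else 0 := by
    intro i
    refine (comm_ofFn_prod_le _ (hg i) F).trans ?_
    split_ifs with h
    · subst h
      refine (Finset.sum_le_sum fun j _ => hc j).trans ?_
      simp
    · simp [h0 i _ h]
  refine (Finset.sum_le_sum fun i _ => this i).trans ?_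
  simp

lemma diag_ofFn_prod {m : ℕ} (d : Fin m → ι → ℂ) :
    (List.ofFn fun i => Matrix.diagonal (d i)).prod = Matrix.diagonal (fun p => ∏ i, d i p) := by
  induction m with
  | zero => simp
  | succ m ih =>
    rw [List.ofFn_succ, List.prod_cons, ih, Matrix.diagonal_mul_diagonal]
    simp [Fin.prod_univ_succ]

/-- Algebra: a controlled unitary is an isometry. -/
lemma ctrl_isom (P C : Matrix ι ι ℂ) (hP : Pᴴ = P) (hPP : P * P = P) (hC : Cᴴ = C)
    (hCC : C * C = 1) (hPC : P * C = C * P) :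
    (P * (C - 1) + 1)ᴴ * (P * (C - 1) + 1) = 1 := by
  have e : (P * (C - 1) + 1)ᴴ = P * (C - 1) + 1 := by
    simp only [Matrix.conjTranspose_add, Matrix.conjTranspose_mul, Matrix.conjTranspose_sub, hP, hC,
      Matrix.conjTranspose_one, sub_mul, mul_sub, hPC, one_mul, mul_one]
  rw [e]
  have h1 : P * (C - 1) * (P * (C - 1)) = P * (2 - 2 * C) := by
    have : P * (C - 1) * (P * (C - 1)) = (P * P) * ((C - 1) * (C - 1)) := by
      have h : (C - 1) * P = P * (C - 1) := by rw [sub_mul, mul_sub, hPC]; simp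
      calc _ = P * ((C - 1) * P) * (C - 1) := by noncomm_ring
        _ = _ := by rw [h]; noncomm_ring
    rw [this, hPP]
    have : (C - 1) * (C - 1) = C * C - 2 * C + 1 := by noncomm_ring
    rw [this, hCC]
    congr 1
    rw [two_mul, ← one_add_one_eq_two]
    abel
  have : (P * (C - 1) + 1) * (P * (C - 1) + 1) = P * (C - 1) * (P * (C - 1)) + 2 * (P * (C - 1)) + 1 := by
    noncomm_ring
  rw [this, h1]
  noncomm_ring

end gen

variable {n l w' : ℕ}


noncomputable def dEq (n l w' : ℕ) (i : Fin l) (j : Fin (w' + 1)) (p : Idx n l w') : ℂ :=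
  if p.1 = p.2.2 (i, j) then 1 else 0

lemma Peq_eq (i : Fin l) (j : Fin (w' + 1)) : Peq n l w' i j = Matrix.diagonal (dEq n l w' i j) := by
  ext p q
  simp only [Peq, Matrix.diagonal_apply, dEq]
  by_cases h : p = q
  · subst h; simp
  · have : ¬ q = p := fun h' => h h'.symm
    simp [h, this]

lemma Peq_herm (i : Fin l) (j : Fin (w' + 1)) : (Peq n l w' i j)ᴴ = Peq n l w' i j := by
  rw [Peq_eq, Matrix.diagonal_conjTranspose]
  congr 1
  ext p
  simp only [dEq, Pi.star_apply]
  split_ifs <;> simp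

lemma Peq_idem (i : Fin l) (j : Fin (w' + 1)) : Peq n l w' i j * Peq n l w' i j = Peq n l w' i j := by
  rw [Peq_eq, Matrix.diagonal_mul_diagonal]
  congr 1
  ext p
  simp only [dEq]
  split_ifs <;> simp

lemma Pneq_eq : Pneq n l w' =
    (List.ofFn fun i : Fin l => (List.ofFn fun j : Fin w' => 1 - Peq n l w' i j.castSucc).prod).prod := by
  have h : ∀ (i : Fin l) (j : Fin w'), 1 - Peq n l w' i j.castSucc =
      Matrix.diagonal (fun p => if p.1 ≠ p.2.2 (i, j.castSucc) then 1 else 0) := by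
    intro i j
    rw [Peq_eq, ← Matrix.diagonal_one, Matrix.diagonal_sub]
    congr 1
    ext p
    simp only [dEq]
    split_ifs <;> simp_all
  simp only [h, diag_ofFn_prod]
  ext p q
  simp only [Pneq, Matrix.diagonal_apply, Finset.prod_ite_zero, Finset.prod_const_one,
    Finset.mem_univ, true_imp_iff]
  by_cases h : p = q
  · subst h; simp
  · have : ¬ q = p := fun h' => h h'.symm
    simp [h, this]

lemma Pneq_diag : Pneq n l w' = Matrix.diagonal (fun p : Idx n l w' =>
    if (∀ (i : Fin l) (j : Fin w'), p.1 ≠ p.2.2 (i, j.castSucc)) then (1 : ℂ) else 0) := by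
  ext p q
  simp only [Pneq, Matrix.diagonal_apply]
  by_cases h : p = q
  · subst h; simp
  · have : ¬ q = p := fun h' => h h'.symm
    simp [h, this]

lemma Pneq_herm : (Pneq n l w')ᴴ = Pneq n l w' := by
  rw [Pneq_diag, Matrix.diagonal_conjTranspose]
  congr 1
  ext p
  simp only [Pi.star_apply]
  split_ifs <;> simp

lemma Pneq_idem : Pneq n l w' * Pneq n l w' = Pneq n l w' := by
  rw [Pneq_diag, Matrix.diagonal_mul_diagonal]
  congr 1
  ext p
  split_ifs <;> simp

lemma compl_herm {ι : Type*} [Fintype ι] [DecidableEq ι] (P : Matrix ι ι ℂ) (h : Pᴴ = P) :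
    (1 - P)ᴴ = 1 - P := by
  simp [h]

lemma compl_idem {ι : Type*} [Fintype ι] [DecidableEq ι] (P : Matrix ι ι ℂ) (h : P * P = P) :
    (1 - P) * (1 - P) = 1 - P := by
  simp [sub_mul, mul_sub, h]

/-- The basis permutation of the transversal CNOT. -/
def fC (i : Fin l) (j : Fin (w' + 1)) (p : Idx n l w') : Idx n l w' :=
  (p.1, (fun t => xor (p.2.1 t) (p.2.2 (i, j) t)), p.2.2)

lemma fC_invol (i : Fin l) (j : Fin (w' + 1)) (p : Idx n l w') : fC i j (fC i j p) = p := by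
  obtain ⟨x, y, γ⟩ := p
  simp [fC]

lemma Cnot_apply (i : Fin l) (j : Fin (w' + 1)) (p q : Idx n l w') :
    Cnot n l w' i j p q = if q = fC i j p then 1 else 0 := by
  obtain ⟨x, y, γ⟩ := p
  obtain ⟨x', y', γ'⟩ := q
  simp only [Cnot, fC, Prod.mk.injEq]
  congr 1
  simp only [eq_iff_iff]
  tauto

lemma fC_eq_iff (i : Fin l) (j : Fin (w' + 1)) (p q : Idx n l w') :
    q = fC i j p ↔ p = fC i j q := by
  constructor
  · rintro rfl; rw [fC_invol]
  · rintro rfl; rw [fC_invol]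

lemma Cnot_mul (i : Fin l) (j : Fin (w' + 1)) (M : Matrix (Idx n l w') (Idx n l w') ℂ)
    (p q : Idx n l w') : (Cnot n l w' i j * M) p q = M (fC i j p) q := by
  simp [Matrix.mul_apply, Cnot_apply]

lemma mul_Cnot (i : Fin l) (j : Fin (w' + 1)) (M : Matrix (Idx n l w') (Idx n l w') ℂ)
    (p q : Idx n l w') : (M * Cnot n l w' i j) p q = M p (fC i j q) := by
  simp [Matrix.mul_apply, Cnot_apply, fC_eq_iff i j _ q]

lemma Cnot_herm (i : Fin l) (j : Fin (w' + 1)) : (Cnot n l w' i j)ᴴ = Cnot n l w' i j := by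
  ext p q
  rw [Matrix.conjTranspose_apply, Cnot_apply, Cnot_apply]
  simp only [fC_eq_iff i j q p]
  split_ifs <;> simp

lemma Cnot_sq (i : Fin l) (j : Fin (w' + 1)) : Cnot n l w' i j * Cnot n l w' i j = 1 := by
  ext p q
  rw [Cnot_mul, Cnot_apply, fC_invol, Matrix.one_apply]
  simp [eq_comm]

lemma Peq_Cnot (i : Fin l) (j k : Fin (w' + 1)) :
    Peq n l w' i j * Cnot n l w' i k = Cnot n l w' i k * Peq n l w' i j := by
  ext p q
  rw [Cnot_mul, Peq_eq, Matrix.diagonal_mul, Matrix.diagonal_apply, Cnot_apply]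
  by_cases h : q = fC i k p
  · subst h
    have hd : dEq n l w' i j (fC i k p) = dEq n l w' i j p := rfl
    simp only [hd, if_true, mul_one]
  · simp [h, Ne.symm h]

lemma Cnot_norm (i : Fin l) (j : Fin (w' + 1)) : ‖Cnot n l w' i j‖ ≤ 1 :=
  norm_le_one_of_isometry _ (by rw [Cnot_herm, Cnot_sq])

lemma Uij_norm (i : Fin l) (j : Fin w') : ‖Uij n l w' i j‖ ≤ 1 :=
  norm_le_one_of_isometry _ (ctrl_isom _ _ (Peq_herm _ _) (Peq_idem _ _) (Cnot_herm _ _)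
    (Cnot_sq _ _) (Peq_Cnot _ _ _))

/-- Reassociation of the registers. -/
def eI (n l w' : ℕ) : Idx n l w' ≃ (Bn n × Bn n) × ((Fin l × Fin (w' + 1)) → Bn n) :=
  (Equiv.prodAssoc _ _ _).symm


def inS (i' : Fin l) (j' : Fin w') (a : Fin l × Fin (w' + 1)) : Prop :=
  a.1 = i' ∧ (a.2 : ℕ) ≤ j'

instance (i' : Fin l) (j' : Fin w') (a : Fin l × Fin (w' + 1)) : Decidable (inS i' j' a) := by
  unfold inS; infer_instance

/-- The `Γ` part of `chainPhi`. -/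
noncomputable def G (n : ℕ) (i' : Fin l) (j' : Fin w') :
    Matrix ((Fin l × Fin (w' + 1)) → Bn n) ((Fin l × Fin (w' + 1)) → Bn n) ℂ :=
  fun γ δ => if ∀ a, ¬ inS i' j' a → γ a = δ a then (((2 : ℂ) ^ n)⁻¹) ^ ((j' : ℕ) + 1) else 0

lemma chainPhi_apply (i' : Fin l) (j' : Fin w') (p q : Idx n l w') :
    chainPhi n l w' i' j' p q = if p.1 = q.1 ∧ p.2.1 = q.2.1 ∧
      (∀ a, ¬ inS i' j' a → p.2.2 a = q.2.2 a) then (((2 : ℂ) ^ n)⁻¹) ^ ((j' : ℕ) + 1) else 0 := by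
  have : (∀ a, ¬ inS i' j' a → p.2.2 a = q.2.2 a) ↔ (∀ (i : Fin l) (k : Fin (w' + 1)),
          (i ≠ i' ∨ (j' : ℕ) < (k : ℕ)) → p.2.2 (i, k) = q.2.2 (i, k)) := by
    rw [Prod.forall]
    refine forall_congr' fun i => forall_congr' fun k => ?_
    simp only [inS, not_and_or, not_le, ne_eq]
  simp only [chainPhi, this]

lemma chainPhi_kron (i' : Fin l) (j' : Fin w') :
    chainPhi n l w' i' j' = ((1 : Matrix (Bn n × Bn n) (Bn n × Bn n) ℂ) ⊗ₖ G n i' j').submatrix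
      (eI n l w') (eI n l w') := by
  ext ⟨x, y, γ⟩ ⟨x', y', γ'⟩
  rw [chainPhi_apply]
  simp only [eI, G, Matrix.submatrix_apply, Equiv.prodAssoc_symm_apply, Matrix.kroneckerMap_apply,
    Matrix.one_apply, Prod.mk.injEq, ite_mul, one_mul, zero_mul]
  split_ifs <;> tauto

lemma Uext_kron (U0 : Matrix (Bn n × Bn n) (Bn n × Bn n) ℂ) :
    Uext n l w' U0 = (U0 ⊗ₖ (1 : Matrix ((Fin l × Fin (w' + 1)) → Bn n) _ ℂ)).submatrix
      (eI n l w') (eI n l w') := by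
  ext ⟨x, y, γ⟩ ⟨x', y', γ'⟩
  simp only [Uext, eI, Matrix.submatrix_apply, Equiv.prodAssoc_symm_apply, Matrix.kroneckerMap_apply,
    Matrix.one_apply, mul_ite, mul_one, mul_zero, eq_comm]

lemma Uext_comm (U0 : Matrix (Bn n × Bn n) (Bn n × Bn n) ℂ) (i' : Fin l) (j' : Fin w') :
    Uext n l w' U0 * chainPhi n l w' i' j' = chainPhi n l w' i' j' * Uext n l w' U0 := by
  rw [Uext_kron, chainPhi_kron, Matrix.submatrix_mul_equiv, Matrix.submatrix_mul_equiv,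
    ← Matrix.mul_kronecker_mul, ← Matrix.mul_kronecker_mul]
  simp

lemma Uext_isom (U0 : Matrix (Bn n × Bn n) (Bn n × Bn n) ℂ) (hU0 : U0ᴴ * U0 = 1) :
    (Uext n l w' U0)ᴴ * Uext n l w' U0 = 1 := by
  rw [Uext_kron, Matrix.conjTranspose_submatrix, Matrix.submatrix_mul_equiv,
    Matrix.conjTranspose_kronecker, ← Matrix.mul_kronecker_mul, hU0]
  simp

lemma chainPhi_herm (i' : Fin l) (j' : Fin w') :
    (chainPhi n l w' i' j')ᴴ = chainPhi n l w' i' j' := by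
  ext p q
  rw [Matrix.conjTranspose_apply, chainPhi_apply, chainPhi_apply]
  simp only [eq_comm (a := q.1), eq_comm (a := q.2.1), eq_comm (a := q.2.2 _)]
  split_ifs <;> simp

lemma card_S (i' : Fin l) (j' : Fin w') :
    (Finset.univ.filter (inS i' j' (w' := w'))).card = j' + 1 := by
  have : (Finset.univ.filter (inS i' j' (w' := w'))) = {i'} ×ˢ (Finset.Iic j'.castSucc) := by
    ext ⟨i, k⟩
    simp only [inS, Finset.mem_filter, Finset.mem_univ, true_and, Finset.mem_product,
      Finset.mem_singleton, Finset.mem_Iic, Fin.le_def, Fin.val_castSucc]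
  rw [this, Finset.card_product]
  simp

lemma card_fiber (i' : Fin l) (j' : Fin w') (γ : (Fin l × Fin (w' + 1)) → Bn n) :
    (Finset.univ.filter (fun δ : (Fin l × Fin (w' + 1)) → Bn n =>
      ∀ a, ¬ inS i' j' a → γ a = δ a)).card = (2 ^ n) ^ ((j' : ℕ) + 1) := by
  have : (Finset.univ.filter (fun δ : (Fin l × Fin (w' + 1)) → Bn n =>
      ∀ a, ¬ inS i' j' a → γ a = δ a)) =
      Fintype.piFinset (fun a => if inS i' j' a then Finset.univ else {γ a}) := by
    ext δ
    simp only [Finset.mem_filter, Finset.mem_univ, true_and, Fintype.mem_piFinset]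
    refine forall_congr' fun a => ?_
    split_ifs with h <;> simp [h, eq_comm]
  rw [this, Fintype.card_piFinset]
  simp only [apply_ite Finset.card, Finset.card_singleton, Finset.prod_ite, Finset.prod_const,
    one_pow, mul_one, card_S]
  simp

lemma card_fiber' (i' : Fin l) (j' : Fin w') (γ : (Fin l × Fin (w' + 1)) → Bn n)
    (b : Fin l × Fin (w' + 1)) (hb : inS i' j' b) (x : Bn n) :
    (Finset.univ.filter (fun δ : (Fin l × Fin (w' + 1)) → Bn n =>
      (∀ a, ¬ inS i' j' a → γ a = δ a) ∧ x = δ b)).card = (2 ^ n) ^ (j' : ℕ) := by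
  have : (Finset.univ.filter (fun δ : (Fin l × Fin (w' + 1)) → Bn n =>
      (∀ a, ¬ inS i' j' a → γ a = δ a) ∧ x = δ b)) =
      Fintype.piFinset (fun a => if inS i' j' a ∧ a ≠ b then Finset.univ else
        {if a = b then x else γ a}) := by
    ext δ
    simp only [Finset.mem_filter, Finset.mem_univ, true_and, Fintype.mem_piFinset]
    constructor
    · rintro ⟨h1, h2⟩ a
      by_cases hab : a = b
      · subst hab; simp [h2]
      · by_cases ha : inS i' j' a
        · simp [ha, hab]
        · simp [ha, hab, h1 a ha]
    · intro h
      refine ⟨fun a ha => ?_, ?_⟩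
      · have hab : a ≠ b := by rintro rfl; exact ha hb
        have := h a
        simp [ha, hab] at this
        exact this.symm
      · have := h b
        simp at this
        exact this.symm
  rw [this, Fintype.card_piFinset]
  have hS : (Finset.univ.filter (fun a => inS i' j' a ∧ a ≠ b)).card = (j' : ℕ) := by
    have : (Finset.univ.filter (fun a => inS i' j' a ∧ a ≠ b)) =
        (Finset.univ.filter (inS i' j' (w' := w'))).erase b := by
      ext a
      simp [and_comm]
    rw [this, Finset.card_erase_of_mem (by simp [hb]), card_S]
    simp
  simp only [apply_ite Finset.card, Finset.card_singleton, Finset.prod_ite, Finset.prod_const,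
    one_pow, mul_one, hS]
  simp

lemma G_idem (i' : Fin l) (j' : Fin w') : G n i' j' * G n i' j' = G n i' j' := by
  ext γ δ
  rw [Matrix.mul_apply]
  set k : ℂ := (((2 : ℂ) ^ n)⁻¹) ^ ((j' : ℕ) + 1) with hk
  have : ∀ ε, G n i' j' γ ε * G n i' j' ε δ =
      if (∀ a, ¬ inS i' j' a → γ a = ε a) then k * G n i' j' γ δ else 0 := by
    intro ε
    by_cases h : ∀ a, ¬ inS i' j' a → γ a = ε a
    · have h' : (∀ a, ¬ inS i' j' a → ε a = δ a) ↔ (∀ a, ¬ inS i' j' a → γ a = δ a) :=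
        forall_congr' fun a => forall_congr' fun ha => by rw [h a ha]
      simp only [G, h', if_pos h]
      rw [hk]
    · simp only [G, if_neg h, zero_mul]
  simp only [this]
  rw [← Finset.sum_filter, Finset.sum_const, card_fiber, nsmul_eq_mul, ← mul_assoc]
  have : (((2 ^ n) ^ ((j' : ℕ) + 1) : ℕ) : ℂ) * k = 1 := by
    rw [hk]; push_cast; rw [← mul_pow, mul_inv_cancel₀ (pow_ne_zero _ two_ne_zero), one_pow]
  rw [this, one_mul]

lemma chainPhi_idem (i' : Fin l) (j' : Fin w') :
    chainPhi n l w' i' j' * chainPhi n l w' i' j' = chainPhi n l w' i' j' := by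
  rw [chainPhi_kron, Matrix.submatrix_mul_equiv, ← Matrix.mul_kronecker_mul, G_idem, one_mul]

lemma Phi_P_Phi (i' : Fin l) (j' : Fin w') (k : Fin (w' + 1)) (hk : (k : ℕ) ≤ j') :
    chainPhi n l w' i' j' * Peq n l w' i' k * chainPhi n l w' i' j' =
      ((2 : ℂ) ^ n)⁻¹ • chainPhi n l w' i' j' := by
  ext ⟨x, y, γ⟩ ⟨x', y', δ⟩
  rw [Matrix.mul_apply, Peq_eq, Matrix.smul_apply]
  simp only [Matrix.mul_diagonal, smul_eq_mul]
  set c : ℂ := (((2 : ℂ) ^ n)⁻¹) ^ ((j' : ℕ) + 1) with hc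
  have : ∀ r : Idx n l w', chainPhi n l w' i' j' (x, y, γ) r * dEq n l w' i' k r *
      chainPhi n l w' i' j' r (x', y', δ) =
      if x = r.1 then if y = r.2.1 then
        if ((∀ a, ¬ inS i' j' a → γ a = r.2.2 a) ∧ x = r.2.2 (i', k)) then
        c * chainPhi n l w' i' j' (x, y, γ) (x', y', δ) else 0 else 0 else 0 := by
    rintro ⟨u, v, ε⟩
    simp only [chainPhi_apply, dEq]
    by_cases hx : x = u
    · subst hx
      by_cases hy : y = v
      · subst hy
        by_cases h : ∀ a, ¬ inS i' j' a → γ a = ε a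
        · have h' : (∀ a, ¬ inS i' j' a → ε a = δ a) ↔ (∀ a, ¬ inS i' j' a → γ a = δ a) :=
            forall_congr' fun a => forall_congr' fun ha => by rw [h a ha]
          by_cases hz : x = ε (i', k)
          · simp only [h', true_and, if_pos h, if_pos hz, and_self, if_true, mul_one,
              if_pos (And.intro h hz)]
            rw [hc]
          · simp [hz]
        · simp only [if_neg h, h, and_false, false_and, if_false, zero_mul, if_true]
      · simp [hy]
    · simp [hx]
  simp only [this]
  rw [Fintype.sum_prod_type]
  simp only [Fintype.sum_prod_type, Finset.sum_ite_irrel, Finset.sum_const_zero,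
    Finset.sum_ite_eq, Finset.mem_univ, if_true]
  rw [← Finset.sum_filter, Finset.sum_const, card_fiber' i' j' γ (i', k) ⟨rfl, hk⟩ x,
    nsmul_eq_mul, ← mul_assoc]
  congr 1
  rw [hc, pow_succ, ← mul_assoc]
  push_cast
  rw [← mul_pow, mul_inv_cancel₀ (pow_ne_zero _ two_ne_zero), one_pow, one_mul]

lemma Phi_norm (i' : Fin l) (j' : Fin w') : ‖chainPhi n l w' i' j'‖ ≤ 1 :=
  norm_le_one_of_proj _ (chainPhi_herm _ _) (chainPhi_idem _ _)

lemma P_Phi_norm (i' : Fin l) (j' : Fin w') (k : Fin (w' + 1)) (hk : (k : ℕ) ≤ j') :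
    ‖Peq n l w' i' k * chainPhi n l w' i' j'‖ ≤ (2 : ℝ) ^ (-(n : ℝ) / 2) := by
  have h := CStarRing.norm_star_mul_self (x := Peq n l w' i' k * chainPhi n l w' i' j')
  rw [Matrix.star_eq_conjTranspose, Matrix.conjTranspose_mul, chainPhi_herm, Peq_herm,
    show chainPhi n l w' i' j' * Peq n l w' i' k * (Peq n l w' i' k * chainPhi n l w' i' j') =
      chainPhi n l w' i' j' * (Peq n l w' i' k * Peq n l w' i' k) * chainPhi n l w' i' j' by
      simp only [mul_assoc], Peq_idem, Phi_P_Phi _ _ _ hk, norm_smul] at h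
  have h2 : ((2 : ℝ) ^ (-(n : ℝ) / 2)) ^ 2 = ((2 : ℝ) ^ n)⁻¹ := by
    rw [← Real.rpow_natCast, ← Real.rpow_mul (by norm_num)]
    rw [show -(n : ℝ) / 2 * ((2 : ℕ) : ℝ) = -(n : ℝ) by push_cast; ring, Real.rpow_neg (by norm_num),
      Real.rpow_natCast]
  refine abs_le_of_sq_le_sq' ?_ (by positivity) |>.2
  rw [h2, sq, ← h]
  have h3 : ‖((2 : ℂ) ^ n)⁻¹‖ = ((2 : ℝ) ^ n)⁻¹ := by simp
  rw [h3]
  exact mul_le_of_le_one_right (by positivity) (Phi_norm _ _)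

lemma Phi_P_norm (i' : Fin l) (j' : Fin w') (k : Fin (w' + 1)) (hk : (k : ℕ) ≤ j') :
    ‖chainPhi n l w' i' j' * Peq n l w' i' k‖ ≤ (2 : ℝ) ^ (-(n : ℝ) / 2) := by
  rw [← Matrix.l2_opNorm_conjTranspose, Matrix.conjTranspose_mul, chainPhi_herm, Peq_herm]
  exact P_Phi_norm _ _ _ hk

lemma P_comm (i' : Fin l) (j' : Fin w') (i : Fin l) (k : Fin (w' + 1)) (h : ¬ inS i' j' (i, k)) :
    Peq n l w' i k * chainPhi n l w' i' j' = chainPhi n l w' i' j' * Peq n l w' i k := by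
  ext p q
  rw [Peq_eq, Matrix.diagonal_mul, Matrix.mul_diagonal, chainPhi_apply]
  split_ifs with hh
  · obtain ⟨h1, h2, h3⟩ := hh
    simp only [dEq, h1, h3 _ h]
    ring
  · simp

lemma C_comm (i' : Fin l) (j' : Fin w') (i : Fin l) (k : Fin (w' + 1)) (h : ¬ inS i' j' (i, k)) :
    Cnot n l w' i k * chainPhi n l w' i' j' = chainPhi n l w' i' j' * Cnot n l w' i k := by
  ext ⟨x, y, γ⟩ ⟨x', y', δ⟩
  rw [Cnot_mul, mul_Cnot, chainPhi_apply, chainPhi_apply]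
  simp only [fC]
  congr 1
  simp only [eq_iff_iff]
  refine and_congr_right fun _ => and_congr_left fun h3 => ?_
  rw [h3 _ h]
  simp only [funext_iff]
  refine forall_congr' fun t => ?_
  cases y t <;> cases y' t <;> cases δ (i, k) t <;> simp

lemma Uij_comm_zero (i' : Fin l) (j' : Fin w') (i : Fin l) (j : Fin w')
    (h : i ≠ i' ∨ (j' : ℕ) < j) :
    Uij n l w' i j * chainPhi n l w' i' j' - chainPhi n l w' i' j' * Uij n l w' i j = 0 := by
  have h1 : ¬ inS i' j' (i, j.castSucc) := by
    simp only [inS, Fin.val_castSucc]; rintro ⟨a, b⟩; rcases h with h | h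
    · exact h a
    · omega
  have h2 : ¬ inS i' j' (i, j.succ) := by
    simp only [inS, Fin.val_succ]; rintro ⟨a, b⟩; rcases h with h | h
    · exact h a
    · omega
  have e1 := P_comm (n := n) i' j' i _ h1
  have e2 := C_comm (n := n) i' j' i _ h2
  have e3 : Commute (Uij n l w' i j) (chainPhi n l w' i' j') :=
    (Commute.mul_left e1 ((show Commute _ _ from e2).sub_left (Commute.one_left _))).add_left
      (Commute.one_left _)
  exact sub_eq_zero.2 e3

lemma CnotSub_norm (i : Fin l) (j : Fin (w' + 1)) : ‖Cnot n l w' i j - 1‖ ≤ 2 := by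
  refine (norm_sub_le _ _).trans ?_
  have := Cnot_norm (n := n) i j
  have := norm_one_le (ι := Idx n l w')
  linarith

lemma Uij_comm_bound (i' : Fin l) (j' : Fin w') (j : Fin w') :
    ‖Uij n l w' i' j * chainPhi n l w' i' j' - chainPhi n l w' i' j' * Uij n l w' i' j‖ ≤
      2 * (2 : ℝ) ^ (-(n : ℝ) / 2) := by
  by_cases h : (j' : ℕ) < j
  · rw [Uij_comm_zero _ _ _ _ (Or.inr h), norm_zero]; positivity
  have hk : (j.castSucc : ℕ) ≤ j' := by simpa using h
  set P := Peq n l w' i' j.castSucc with hP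
  set V := Cnot n l w' i' j.succ - 1 with hV
  set F := chainPhi n l w' i' j' with hF
  have hPV : P * V = V * P := by
    rw [hV, mul_sub, sub_mul, hP, Peq_Cnot]; simp
  have hVn : ‖V‖ ≤ 2 := CnotSub_norm _ _
  have e : Uij n l w' i' j * F - F * Uij n l w' i' j = P * V * F - F * (P * V) := by
    rw [Uij, ← hP, ← hV]; noncomm_ring
  have n1 : ‖P * F‖ ≤ _ := P_Phi_norm i' j' _ hk
  have n2 : ‖F * P‖ ≤ _ := Phi_P_norm i' j' _ hk
  rw [e]
  refine comm_bound _ _ (chainPhi_herm _ _) (chainPhi_idem _ _) _ ?_ ?_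
  · rw [hPV, mul_assoc]
    exact (norm_mul_le _ _).trans (mul_le_mul hVn n1 (norm_nonneg _) (by norm_num))
  · rw [← mul_assoc, mul_comm (2 : ℝ)]
    exact (norm_mul_le _ _).trans (mul_le_mul n2 hVn (norm_nonneg _) (by positivity))

lemma compl_comm (P F : Matrix (Idx n l w') (Idx n l w') ℂ) :
    ‖(1 - P) * F - F * (1 - P)‖ = ‖P * F - F * P‖ := by
  rw [← norm_neg]; congr 1; noncomm_ring

lemma Pneq_comm_bound (i' : Fin l) (j' : Fin w') :
    ‖Pneq n l w' * chainPhi n l w' i' j' - chainPhi n l w' i' j' * Pneq n l w'‖ ≤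
      w' * (2 : ℝ) ^ (-(n : ℝ) / 2) := by
  rw [Pneq_eq]
  refine nested_bound (fun i j => 1 - Peq n l w' i j.castSucc) ?_ _ i' _ ?_ ?_
  · exact fun i j => norm_le_one_of_proj _ (compl_herm _ (Peq_herm _ _)) (compl_idem _ (Peq_idem _ _))
  · intro i j h
    rw [← norm_eq_zero, compl_comm, P_comm _ _ _ _ (fun h' => h h'.1), sub_self, norm_zero]
  · intro j
    rw [compl_comm]
    by_cases h : (j' : ℕ) < j
    · rw [P_comm _ _ _ _ (fun h' => by have := h'.2; simp at this; omega), sub_self, norm_zero]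
      positivity
    · have hk : (j.castSucc : ℕ) ≤ j' := by simpa using h
      exact comm_bound _ _ (chainPhi_herm _ _) (chainPhi_idem _ _) _ (P_Phi_norm _ _ _ hk)
        (Phi_P_norm _ _ _ hk)

lemma main_bound (U0 : Matrix (Bn n × Bn n) (Bn n × Bn n) ℂ) (hU0 : U0ᴴ * U0 = 1)
    (i' : Fin l) (j' : Fin w') :
    ‖Uh n l w' U0 * chainPhi n l w' i' j' - chainPhi n l w' i' j' * Uh n l w' U0‖ ≤
      6 * w' * (2 : ℝ) ^ (-(n : ℝ) / 2) := by
  have hC : ‖_‖ ≤ _ := nested_bound (fun i j => Uij n l w' i j) (fun i j => Uij_norm i j)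
    (chainPhi n l w' i' j') i' _ (fun i j h => Uij_comm_zero _ _ _ _ (Or.inl h))
    (fun j => Uij_comm_bound i' j' j)
  have hCn : ‖_‖ ≤ _ := norm_ofFn_prod_le (fun i : Fin l =>
    (List.ofFn fun j : Fin w' => Uij n l w' i j).prod)
    (fun i => norm_ofFn_prod_le _ (fun j => Uij_norm i j))
  rw [Uh]
  set C := (List.ofFn fun i : Fin l => (List.ofFn fun j : Fin w' => Uij n l w' i j).prod).prod
  have hP := Pneq_comm_bound (n := n) i' j'
  have hW := norm_le_one_of_isometry _ (Uext_isom (l := l) (w' := w') U0 hU0)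
  have hPn : ‖Pneq n l w'‖ ≤ 1 := norm_le_one_of_proj _ Pneq_herm Pneq_idem
  have hPn' : ‖1 - Pneq n l w'‖ ≤ 1 :=
    norm_le_one_of_proj _ (compl_herm _ Pneq_herm) (compl_idem _ Pneq_idem)
  have hWF := Uext_comm U0 i' j'
  have h1 := norm_one_le (ι := Idx n l w')
  rw [Uneq]
  set F := chainPhi n l w' i' j'
  set P := Pneq n l w'
  set W := Uext n l w' U0
  set c := (2 : ℝ) ^ (-(n : ℝ) / 2)
  have hc : 0 ≤ c := by positivity
  have hU : ‖P * (W - 1) + 1‖ ≤ 2 := by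
    have e : P * (W - 1) + 1 = P * W + (1 - P) := by noncomm_ring
    rw [e]
    have : ‖P * W‖ ≤ 1 := (norm_mul_le _ _).trans (mul_le_one₀ hPn (norm_nonneg _) hW)
    refine (norm_add_le _ _).trans ?_
    linarith
  have hW1 : ‖W - 1‖ ≤ 2 := (norm_sub_le _ _).trans (by linarith)
  have e : C * (P * (W - 1) + 1) * F - F * (C * (P * (W - 1) + 1)) =
      C * ((P * F - F * P) * (W - 1)) + (C * F - F * C) * (P * (W - 1) + 1) := by
    have e1 : (W - 1) * F = F * (W - 1) := by rw [sub_mul, mul_sub, hWF]; simp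
    have e2 : C * (P * (W - 1) + 1) * F = C * P * ((W - 1) * F) + C * F := by noncomm_ring
    rw [e2, e1]
    noncomm_ring
  rw [e]
  have t1 : ‖(P * F - F * P) * (W - 1)‖ ≤ (w' * c) * 2 :=
    (norm_mul_le _ _).trans (mul_le_mul hP hW1 (norm_nonneg _) (by positivity))
  have t2 : ‖C * ((P * F - F * P) * (W - 1))‖ ≤ (w' * c) * 2 :=
    (norm_mul_le _ _).trans ((mul_le_of_le_one_left (norm_nonneg _) hCn).trans t1)
  have t3 : ‖(C * F - F * C) * (P * (W - 1) + 1)‖ ≤ (w' * (2 * c)) * 2 :=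
    (norm_mul_le _ _).trans (mul_le_mul hC hU (norm_nonneg _) (by positivity))
  refine (norm_add_le _ _).trans ?_
  linarith

end helpers

/-- Commutator bound for hash chains in the QROM: for any chain index `i'` and any
position `j' ∈ {0,…,w−2}`, the commutator of the superposition-oracle hash unitary
`U_h` with the uniform-superposition projector on the first `j'+1` elements of the
`i'`-th chain has operator norm at most `6(w−1)·2^{−n/2}` (here `w = w'+1 ≥ 2`). -/
theorem stmt_9 (n l w' : ℕ) (hw : 1 ≤ w')
    (U0 : Matrix (Bn n × Bn n) (Bn n × Bn n) ℂ) (hU0 : U0ᴴ * U0 = 1)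
    (i' : Fin l) (j' : Fin w') :
    ‖Matrix.toEuclideanCLM (𝕜 := ℂ)
        (Uh n l w' U0 * chainPhi n l w' i' j' -
         chainPhi n l w' i' j' * Uh n l w' U0)‖ ≤
      6 * w' * (2 : ℝ) ^ (-(n : ℝ) / 2) := by
  exact main_bound U0 hU0 i' j'

end Stmt9
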